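/- Fix 0 < α < 1. Let Λ ⊂ ℝⁿ be a nonempty closed set of Lebesgue measure zero and let f ∈ L_{2α}(ℝⁿ) be smooth and positive on ℝⁿ ∖ Λ with K⁻¹ d₀(y,Λ)^{−q} ≤ f(y) ≤ K d₀(y,Λ)^{−q} for all y ∈ ℝⁿ ∖ Λ, for some constants K > 0, q > 0; assume also f ∈ L^τ_loc(ℝⁿ) for some τ > 1. Let f_ε = f ∗ η_ε. Then for every x ∈ ℝⁿ ∖ Λ, lim_{ε→0} L_α(log f_ε)(x) = L_α(log f)(x), where L_α g(x) = −∫_{ℝⁿ} (g(x+y)+g(x−y)−2g(x))/|y|^{n+2α} dy. -/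

import Mathlib

open MeasureTheory Metric Set Filter

/-- The standard mollification `f_ε = f ∗ η_ε`, where `η_ε(x) = ε^{-n} η(x/ε)`. -/
noncomputable def mollify {n : ℕ} (η f : EuclideanSpace ℝ (Fin n) → ℝ) (ε : ℝ)
    (x : EuclideanSpace ℝ (Fin n)) : ℝ :=
  ∫ y : EuclideanSpace ℝ (Fin n), f (x - y) * ((ε ^ n)⁻¹ * η (ε⁻¹ • y))

/-- Up to a positive constant, the fractional Laplacian of order `α` written via second
differences: `L_α g (x) = -∫ (g(x+y)+g(x-y)-2g(x))/|y|^{n+2α} dy`. -/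
noncomputable def fracLap (n : ℕ) (α : ℝ) (g : EuclideanSpace ℝ (Fin n) → ℝ)
    (x : EuclideanSpace ℝ (Fin n)) : ℝ :=
  -∫ y : EuclideanSpace ℝ (Fin n),
      (g (x + y) + g (x - y) - 2 * g x) / ‖y‖ ^ ((n : ℝ) + 2 * α)

/-- A probability density `ρ`, bounded by `B` and vanishing outside the open ball of radius `ε`. -/
structure IsBallDensity {E : Type*} [NormedAddCommGroup E] [MeasureSpace E]
    (ρ : E → ℝ) (ε B : ℝ) : Prop where
  measurable : Measurable ρ
  nonneg : ∀ z, 0 ≤ ρ z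
  integral_eq_one : ∫ z, ρ z = 1
  le_bound : ∀ z, ρ z ≤ B
  eq_zero : ∀ z, ε ≤ ‖z‖ → ρ z = 0

namespace IsBallDensity

variable {E : Type*} [NormedAddCommGroup E] [MeasureSpace E] {ρ F f : E → ℝ} {ε B a p : ℝ}

theorem integrable (h : IsBallDensity ρ ε B) : Integrable ρ :=
  integrable_of_integral_eq_one h.integral_eq_one

theorem abs_integral_mul_le (h : IsBallDensity ρ ε B) (hF : ∀ᵐ z, ‖z‖ < ε → |F z| ≤ a) :
    |∫ z, F z * ρ z| ≤ a := by
  have key : ‖∫ z, F z * ρ z‖ ≤ ∫ z, a * ρ z := by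
    refine norm_integral_le_of_norm_le (h.integrable.const_mul a) ?_
    filter_upwards [hF] with z hz
    rcases lt_or_ge ‖z‖ ε with hlt | hge
    · rw [Real.norm_eq_abs, abs_mul, abs_of_nonneg (h.nonneg z)]
      exact mul_le_mul_of_nonneg_right (hz hlt) (h.nonneg z)
    · simp [h.eq_zero z hge]
  rwa [integral_const_mul, h.integral_eq_one, mul_one] at key

theorem le_integral_mul (h : IsBallDensity ρ ε B) (hint : Integrable fun z => F z * ρ z)
    (hF : ∀ᵐ z, ‖z‖ < ε → a ≤ F z) : a ≤ ∫ z, F z * ρ z := by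
  have key : ∫ z, a * ρ z ≤ ∫ z, F z * ρ z := by
    refine integral_mono_ae (h.integrable.const_mul a) hint ?_
    filter_upwards [hF] with z hz
    rcases lt_or_ge ‖z‖ ε with hlt | hge
    · exact mul_le_mul_of_nonneg_right (hz hlt) (h.nonneg z)
    · simp [h.eq_zero z hge]
  rwa [integral_const_mul, h.integral_eq_one, mul_one] at key

theorem integral_mul_le (h : IsBallDensity ρ ε B) (hint : Integrable fun z => F z * ρ z)
    (hF : ∀ᵐ z, ‖z‖ < ε → F z ≤ a) : ∫ z, F z * ρ z ≤ a := by
  have key : ∫ z, F z * ρ z ≤ ∫ z, a * ρ z := by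
    refine integral_mono_ae hint (h.integrable.const_mul a) ?_
    filter_upwards [hF] with z hz
    rcases lt_or_ge ‖z‖ ε with hlt | hge
    · exact mul_le_mul_of_nonneg_right (hz hlt) (h.nonneg z)
    · simp [h.eq_zero z hge]
  rwa [integral_const_mul, h.integral_eq_one, mul_one] at key

theorem abs_mul_le (h : IsBallDensity ρ ε B) (hp : 0 ≤ p) (hε : ε ≤ 1) (y z : E) :
    |f (y - z) * ρ z| ≤ 2 * B * (1 + ‖y‖) ^ p * (|f (y - z)| / (1 + ‖y - z‖ ^ p)) := by
  have hB : 0 ≤ B := (h.nonneg 0).trans (h.le_bound 0)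
  rcases lt_or_ge ‖z‖ ε with hlt | hge
  · have h1 : ‖y - z‖ ≤ 1 + ‖y‖ := by linarith [norm_sub_le y z]
    have h2 : ‖y - z‖ ^ p ≤ (1 + ‖y‖) ^ p := Real.rpow_le_rpow (norm_nonneg _) h1 hp
    have h3 : 1 ≤ (1 + ‖y‖) ^ p := Real.one_le_rpow (by linarith [norm_nonneg y]) hp
    have h4 : 0 < 1 + ‖y - z‖ ^ p := by positivity
    rw [abs_mul, abs_of_nonneg (h.nonneg z), mul_div_assoc', le_div_iff₀ h4]
    calc |f (y - z)| * ρ z * (1 + ‖y - z‖ ^ p)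
        ≤ |f (y - z)| * B * (2 * (1 + ‖y‖) ^ p) := by
          gcongr
          · exact h.le_bound z
          · linarith
      _ = _ := by ring
  · rw [h.eq_zero z hge, mul_zero, abs_zero]
    positivity

variable [BorelSpace E] [NormedSpace ℝ E] [FiniteDimensional ℝ E]
  [(volume : Measure E).IsAddHaarMeasure]

theorem integrable_mul (h : IsBallDensity ρ ε B) (hp : 0 ≤ p) (hε : ε ≤ 1) (hf : Measurable f)
    (hfL : Integrable fun x => |f x| / (1 + ‖x‖ ^ p)) (y : E) :
    Integrable fun z => f (y - z) * ρ z := by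
  refine Integrable.mono' ((hfL.comp_sub_left y).const_mul (2 * B * (1 + ‖y‖) ^ p)) ?_ ?_
  · exact ((hf.comp (measurable_const.sub measurable_id)).mul h.measurable).aestronglyMeasurable
  · exact Eventually.of_forall fun z => h.abs_mul_le hp hε y z

theorem integral_mul_le_weighted (h : IsBallDensity ρ ε B) (hp : 0 ≤ p) (hε : ε ≤ 1)
    (hfL : Integrable fun x => |f x| / (1 + ‖x‖ ^ p)) (y : E) :
    ∫ z, f (y - z) * ρ z ≤ 2 * B * (1 + ‖y‖) ^ p * ∫ x, |f x| / (1 + ‖x‖ ^ p) := by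
  have key : ‖∫ z, f (y - z) * ρ z‖ ≤ _ := norm_integral_le_of_norm_le
    ((hfL.comp_sub_left y).const_mul (2 * B * (1 + ‖y‖) ^ p))
    (Eventually.of_forall fun z => h.abs_mul_le hp hε y z)
  rw [integral_const_mul, integral_sub_left_eq_self (fun x => |f x| / (1 + ‖x‖ ^ p))] at key
  exact (le_abs_self _).trans key

end IsBallDensity

/-- Rescaling a mollifier gives a density on the ball of radius `ε`. -/
theorem isBallDensity_rescale {n : ℕ} {η : EuclideanSpace ℝ (Fin n) → ℝ} (hη : Continuous η)
    (hηs : tsupport η ⊆ ball (0 : EuclideanSpace ℝ (Fin n)) 1) (hηnn : ∀ x, 0 ≤ η x)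
    (hηint : (∫ x, η x) = 1) {M : ℝ} (hM : ∀ x, η x ≤ M) {ε : ℝ} (hε : 0 < ε) :
    IsBallDensity (fun z => (ε ^ n)⁻¹ * η (ε⁻¹ • z)) ε ((ε ^ n)⁻¹ * M) where
  measurable := (continuous_const.mul (hη.comp (continuous_const_smul _))).measurable
  nonneg z := mul_nonneg (by positivity) (hηnn _)
  integral_eq_one := by
    rw [integral_const_mul, Measure.integral_comp_inv_smul_of_nonneg _ _ hε.le, hηint,
      finrank_euclideanSpace_fin, smul_eq_mul, mul_one, inv_mul_cancel₀ (by positivity)]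
  le_bound z := mul_le_mul_of_nonneg_left (hM _) (by positivity)
  eq_zero z hz := by
    have : η (ε⁻¹ • z) = 0 := by
      refine image_eq_zero_of_notMem_tsupport fun hmem => ?_
      have := hηs hmem
      rw [mem_ball_zero_iff, norm_smul, norm_inv, Real.norm_of_nonneg hε.le, ← div_eq_inv_mul,
        div_lt_one hε] at this
      linarith
    rw [this, mul_zero]

theorem exists_forall_le_of_tsupport_subset_ball {E : Type*} [NormedAddCommGroup E]
    [ProperSpace E] {η : E → ℝ} (hη : Continuous η)
    (hηs : tsupport η ⊆ ball (0 : E) 1) : ∃ M, 0 < M ∧ ∀ x, η x ≤ M := by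
  have hc : HasCompactSupport η :=
    HasCompactSupport.of_support_subset_isCompact (isCompact_closedBall (0 : E) 1)
      ((subset_tsupport η).trans (hηs.trans ball_subset_closedBall))
  obtain ⟨C, hC⟩ := hη.bounded_above_of_compact_support hc
  exact ⟨max C 1, lt_max_of_lt_right one_pos,
    fun x => ((le_abs_self _).trans (hC x)).trans (le_max_left _ _)⟩

/-- A second difference of logarithms is controlled by first and second differences. -/
theorem abs_log_second_difference_le {a b c m M L S : ℝ} (hm : 0 < m) (ha : m ≤ a) (hb : m ≤ b)
    (hc : m ≤ c) (hcM : c ≤ M) (hac : |a - c| ≤ L) (hbc : |b - c| ≤ L)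
    (habc : |a + b - 2 * c| ≤ S) :
    |Real.log a + Real.log b - 2 * Real.log c| ≤ (M * S + L ^ 2) / m ^ 2 := by
  have ha0 := hm.trans_le ha
  have hb0 := hm.trans_le hb
  have hc0 := hm.trans_le hc
  have hnum : |a * b - c ^ 2| ≤ M * S + L ^ 2 := by
    have : a * b - c ^ 2 = c * (a + b - 2 * c) + (a - c) * (b - c) := by ring
    rw [this]
    refine (abs_add_le _ _).trans ?_
    rw [abs_mul, abs_mul, abs_of_pos hc0, sq]
    have hL : 0 ≤ L := (abs_nonneg _).trans hac
    gcongr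
    exact hc0.le.trans hcM
  have hlog : Real.log a + Real.log b - 2 * Real.log c = Real.log (a * b) - Real.log (c ^ 2) := by
    rw [Real.log_mul ha0.ne' hb0.ne', Real.log_pow]; norm_num
  rw [hlog, abs_le]
  constructor
  · have h1 := Real.log_le_sub_one_of_pos (show 0 < c ^ 2 / (a * b) by positivity)
    rw [Real.log_div (by positivity) (by positivity)] at h1
    have h2 : c ^ 2 / (a * b) - 1 ≤ (M * S + L ^ 2) / m ^ 2 := by
      rw [div_sub_one (by positivity)]
      have := neg_abs_le (a * b - c ^ 2)
      refine div_le_div₀ ((abs_nonneg _).trans hnum) (by linarith) (by positivity) ?_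
      rw [sq]; gcongr
    linarith
  · have h1 := Real.log_le_sub_one_of_pos (show 0 < a * b / c ^ 2 by positivity)
    rw [Real.log_div (by positivity) (by positivity)] at h1
    have h2 : a * b / c ^ 2 - 1 ≤ (M * S + L ^ 2) / m ^ 2 := by
      rw [div_sub_one (by positivity)]
      have := le_abs_self (a * b - c ^ 2)
      refine div_le_div₀ ((abs_nonneg _).trans hnum) (by linarith) (by positivity) ?_
      gcongr
    linarith

/-- Near a point where `f` is `C²`, its first differences are `O(‖y‖)` and its second differences
are `O(‖y‖²)`, uniformly in the base point. -/
theorem exists_difference_bounds {E : Type*} [NormedAddCommGroup E] [NormedSpace ℝ E]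
    {f : E → ℝ} {x : E} (hf : ContDiffAt ℝ 2 f x) :
    ∃ r > 0, ∃ L ≥ 0, ∀ z ∈ ball x r, ∀ y ∈ ball (0 : E) r,
      |f (z + y) - f z| ≤ L * ‖y‖ ∧ |f (z + y) + f (z - y) - 2 * f z| ≤ L * ‖y‖ ^ 2 := by
  obtain ⟨K₁, t₁, ht₁, hK₁⟩ := (hf.of_le one_le_two).exists_lipschitzOnWith
  obtain ⟨K₂, t₂, ht₂, hK₂⟩ :=
    (hf.fderiv_right (m := 1) (by norm_num)).exists_lipschitzOnWith
  have hd : ∀ᶠ z in nhds x, DifferentiableAt ℝ f z :=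
    (hf.eventually (by simp)).mono fun z hz => hz.differentiableAt (by norm_num)
  obtain ⟨R, hR, hball⟩ := Metric.mem_nhds_iff.1 (inter_mem (inter_mem ht₁ ht₂) hd)
  have hmem : ∀ z ∈ ball x (R / 2), ∀ w : E, ‖w‖ < R / 2 → z + w ∈ ball x R := by
    intro z hz w hw
    rw [mem_ball] at hz ⊢
    calc dist (z + w) x ≤ dist (z + w) z + dist z x := dist_triangle _ _ _
      _ = ‖w‖ + dist z x := by rw [dist_eq_norm, add_sub_cancel_left]
      _ < R := by linarith
  refine ⟨R / 2, by positivity, max K₁ (2 * K₂), by positivity, fun z hz y hy => ?_⟩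
  rw [mem_ball_zero_iff] at hy
  have hz0 : z ∈ ball x R := ball_subset_ball (by linarith) hz
  constructor
  · have h1 := hK₁.dist_le_mul _ (hball (hmem z hz y hy)).1.1 _ (hball hz0).1.1
    rw [Real.dist_eq, dist_eq_norm, add_sub_cancel_left] at h1
    exact h1.trans (by gcongr; exact le_max_left _ _)
  · have hty : ∀ t ∈ Icc (0 : ℝ) 1, ‖t • y‖ < R / 2 := fun t ht => by
      rw [norm_smul, Real.norm_of_nonneg ht.1]
      exact (mul_le_of_le_one_left (norm_nonneg _) ht.2).trans_lt hy
    have hp : ∀ t ∈ Icc (0 : ℝ) 1, z + t • y ∈ ball x R := fun t ht => hmem z hz _ (hty t ht)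
    have hn : ∀ t ∈ Icc (0 : ℝ) 1, z - t • y ∈ ball x R := fun t ht => by
      rw [sub_eq_add_neg]
      exact hmem z hz _ (by rw [norm_neg]; exact hty t ht)
    have hderiv : ∀ t ∈ Icc (0 : ℝ) 1,
        HasDerivWithinAt (fun t : ℝ => f (z + t • y) + f (z - t • y))
          (fderiv ℝ f (z + t • y) y - fderiv ℝ f (z - t • y) y) (Icc 0 1) t := by
      intro t ht
      have hl : HasDerivAt (fun t : ℝ => t • y) y t := by
        simpa using (hasDerivAt_id t).smul_const y
      have h1 := (hball (hp t ht)).2.hasFDerivAt.comp_hasDerivAt t (hl.const_add z)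
      have h2 := (hball (hn t ht)).2.hasFDerivAt.comp_hasDerivAt t (hl.const_sub z)
      have h3 := h1.add h2
      rw [map_neg, ← sub_eq_add_neg] at h3
      exact h3.hasDerivWithinAt
    have key := norm_image_sub_le_of_norm_deriv_le_segment_01' hderiv
      (C := 2 * K₂ * ‖y‖ ^ 2) (fun t ht => by
        have ht' := Ico_subset_Icc_self ht
        have h1 := hK₂.dist_le_mul _ (hball (hp t ht')).1.2 _ (hball (hn t ht')).1.2
        have h2 : dist (z + t • y) (z - t • y) ≤ 2 * ‖y‖ := by
          rw [dist_eq_norm, show z + t • y - (z - t • y) = (2 * t) • y by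
            rw [mul_smul, two_smul]; abel, norm_smul, Real.norm_of_nonneg (by linarith [ht.1])]
          gcongr
          linarith [ht.2]
        rw [← sub_apply]
        calc _ ≤ ‖fderiv ℝ f (z + t • y) - fderiv ℝ f (z - t • y)‖ * ‖y‖ :=
              ContinuousLinearMap.le_opNorm _ _
          _ ≤ (K₂ * (2 * ‖y‖)) * ‖y‖ := by
              gcongr
              rw [← dist_eq_norm]
              exact h1.trans (by gcongr)
          _ = _ := by ring)
    simp only [one_smul, zero_smul, add_zero, sub_zero, ← two_mul] at key
    exact key.trans (by gcongr; exact le_max_right _ _)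

/-- Near a point where `f` is `C²` and positive, second differences of the logarithms of small-scale
averages of `f` are `O(‖y‖²)`, uniformly in the scale. -/
theorem exists_abs_log_average_second_difference_le {E : Type*}
    [NormedAddCommGroup E] [MeasureSpace E] [NormedSpace ℝ E] {f : E → ℝ} {x : E}
    (hf : ContDiffAt ℝ 2 f x)
    (hfx : 0 < f x) :
    ∃ r > 0, ∃ C ≥ 0, ∀ (ε B : ℝ) (ρ : E → ℝ), ε ≤ r → IsBallDensity ρ ε B →
      (∀ y, Integrable fun z => f (y - z) * ρ z) → ∀ y : E, ‖y‖ < r →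
        |Real.log (∫ z, f (x + y - z) * ρ z) + Real.log (∫ z, f (x - y - z) * ρ z)
          - 2 * Real.log (∫ z, f (x - z) * ρ z)| ≤ C * ‖y‖ ^ 2 := by
  obtain ⟨r₁, hr₁, L, hL, hdiff⟩ := exists_difference_bounds hf
  obtain ⟨r₂, hr₂, hmid⟩ := Metric.eventually_nhds_iff.1
    ((hf.continuousAt.eventually (lt_mem_nhds (half_lt_self hfx))).and
      (hf.continuousAt.eventually (gt_mem_nhds (show f x < 2 * f x by linarith))))
  refine ⟨min r₁ (r₂ / 2), by positivity, (2 * f x * L + L ^ 2) / (f x / 2) ^ 2, by positivity,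
    fun ε B ρ hε hρ hint y hy => ?_⟩
  have hy₁ : ‖y‖ < r₁ := hy.trans_le (min_le_left _ _)
  have hy₂ : ‖y‖ < r₂ / 2 := hy.trans_le (min_le_right _ _)
  have hz₁ : ∀ z : E, ‖z‖ < ε → x - z ∈ ball x r₁ := fun z hz => by
    rw [mem_ball, dist_eq_norm, sub_sub_cancel_left, norm_neg]
    exact hz.trans_le (hε.trans (min_le_left _ _))
  have hz₂ : ∀ z : E, ‖z‖ < ε → ‖z‖ < r₂ / 2 := fun z hz =>
    hz.trans_le (hε.trans (min_le_right _ _))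
  have hlow : ∀ w : E, ‖w‖ < r₂ / 2 → f x / 2 ≤ ∫ z, f (x + w - z) * ρ z := fun w hw => by
    refine hρ.le_integral_mul (hint _) (Eventually.of_forall fun z hz => (hmid ?_).1.le)
    rw [dist_eq_norm, add_sub_assoc, add_sub_cancel_left]
    linarith [norm_sub_le w z, hz₂ z hz]
  have hup : ∫ z, f (x - z) * ρ z ≤ 2 * f x := by
    refine hρ.integral_mul_le (hint _) (Eventually.of_forall fun z hz => (hmid ?_).2.le)
    rw [dist_eq_norm, sub_sub_cancel_left, norm_neg]
    linarith [hz₂ z hz]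
  have hfirst : ∀ w : E, ‖w‖ = ‖y‖ →
      |(∫ z, f (x + w - z) * ρ z) - ∫ z, f (x - z) * ρ z| ≤ L * ‖y‖ := fun w hw => by
    rw [← integral_sub (hint _) (hint _)]
    simp_rw [← sub_mul]
    refine hρ.abs_integral_mul_le (Eventually.of_forall fun z hz => ?_)
    rw [← hw, add_sub_right_comm]
    exact (hdiff _ (hz₁ z hz) w (by rw [mem_ball_zero_iff, hw]; exact hy₁)).1
  have hsecond : |(∫ z, f (x + y - z) * ρ z) + (∫ z, f (x - y - z) * ρ z)
      - 2 * ∫ z, f (x - z) * ρ z| ≤ L * ‖y‖ ^ 2 := by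
    rw [← integral_const_mul, ← integral_add (hint _) (hint _),
      ← integral_sub (by exact (hint _).add (hint _)) ((hint _).const_mul 2)]
    simp_rw [← mul_assoc, ← add_mul, ← sub_mul]
    refine hρ.abs_integral_mul_le (Eventually.of_forall fun z hz => ?_)
    rw [add_sub_right_comm x y z, sub_right_comm x y z]
    exact (hdiff _ (hz₁ z hz) y (by rwa [mem_ball_zero_iff])).2
  have hlow' := hlow (-y) (by rwa [norm_neg])
  have hfirst' := hfirst (-y) (norm_neg y)
  rw [← sub_eq_add_neg] at hlow' hfirst'
  have hlow₀ := hlow 0 (by rw [norm_zero]; positivity)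
  rw [add_zero] at hlow₀
  refine (abs_log_second_difference_le (half_pos hfx) (hlow y hy₂) hlow' hlow₀ hup
    (hfirst y rfl) hfirst' hsecond).trans_eq ?_
  ring

theorem ae_add_notMem {E : Type*} [NormedAddCommGroup E] [MeasureSpace E] [BorelSpace E]
    [(volume : Measure E).IsAddHaarMeasure] {Λ : Set E} (hΛ0 : volume Λ = 0) (y : E) :
    ∀ᵐ z : E, y + z ∉ Λ :=
  (measurePreserving_add_left volume y).quasiMeasurePreserving.ae
    (measure_eq_zero_iff_ae_notMem.1 hΛ0)

section LogMollification

variable {E : Type*} [NormedAddCommGroup E] [MeasureSpace E] [BorelSpace E] [NormedSpace ℝ E]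
  [FiniteDimensional ℝ E] [(volume : Measure E).IsAddHaarMeasure] {f : E → ℝ}

theorem ae_sub_notMem {Λ : Set E} (hΛ0 : volume Λ = 0) (y : E) : ∀ᵐ z : E, y - z ∉ Λ :=
  (Measure.measurePreserving_sub_left volume y).quasiMeasurePreserving.ae
    (measure_eq_zero_iff_ae_notMem.1 hΛ0)

/-- If `f` is comparable to a negative power of the distance to a null set, then the averages of
`f` on small balls are bounded below by a negative power of the norm. -/
theorem IsBallDensity.lower_bound {Λ : Set E} (hΛne : Λ.Nonempty) (hΛc : IsClosed Λ)
    (hΛ0 : volume Λ = 0) {K q : ℝ} (hK : 0 < K) (hq : 0 < q)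
    (hbound : ∀ y ∉ Λ, K⁻¹ * infDist y Λ ^ (-q) ≤ f y) {ρ : E → ℝ} {ε B : ℝ}
    (h : IsBallDensity ρ ε B) (hε : ε ≤ 1) {y : E}
    (hint : Integrable fun z => f (y - z) * ρ z) :
    K⁻¹ * ((1 + infDist 0 Λ) * (1 + ‖y‖)) ^ (-q) ≤ ∫ z, f (y - z) * ρ z := by
  refine h.le_integral_mul hint ?_
  filter_upwards [ae_sub_notMem hΛ0 y] with z hz hzε
  refine le_trans ?_ (hbound _ hz)
  have hpos := (hΛc.notMem_iff_infDist_pos hΛne).1 hz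
  have h1 : infDist (y - z) Λ ≤ infDist 0 Λ + (‖y‖ + ‖z‖) := by
    refine (infDist_le_infDist_add_dist (y := 0)).trans ?_
    rw [dist_zero_right]
    gcongr
    exact norm_sub_le y z
  have h2 : infDist (y - z) Λ ≤ (1 + infDist 0 Λ) * (1 + ‖y‖) := by
    have : 0 ≤ infDist 0 Λ * ‖y‖ := mul_nonneg infDist_nonneg (norm_nonneg y)
    linarith
  refine mul_le_mul_of_nonneg_left ?_ (by positivity)
  exact Real.rpow_le_rpow_of_nonpos hpos h2 (by linarith)

theorem exists_abs_log_average_le {Λ : Set E} (hΛne : Λ.Nonempty) (hΛc : IsClosed Λ)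
    (hΛ0 : volume Λ = 0) (hf : Measurable f) {p : ℝ} (hp : 0 ≤ p)
    (hfL : Integrable fun x => |f x| / (1 + ‖x‖ ^ p)) {K q : ℝ} (hK : 0 < K) (hq : 0 < q)
    (hbound : ∀ y ∉ Λ, K⁻¹ * infDist y Λ ^ (-q) ≤ f y ∧ f y ≤ K * infDist y Λ ^ (-q))
    {M : ℝ} (hM : 0 < M) (n : ℕ) {α : ℝ} (hα : 0 < α) :
    ∃ C, 0 ≤ C ∧ ∀ (ε : ℝ) (ρ : E → ℝ), 0 < ε → ε ≤ 1 → IsBallDensity ρ ε ((ε ^ n)⁻¹ * M) →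
      ∀ y ∉ Λ, |Real.log (∫ z, f (y - z) * ρ z)| ≤ C * ((1 + ‖y‖) ^ α + |f y|) := by
  set J := ∫ x, |f x| / (1 + ‖x‖ ^ p) with hJ
  have hJ0 : 0 ≤ J := integral_nonneg fun x => by positivity
  set A := 1 + infDist 0 Λ with hA
  have hA1 : 1 ≤ A := by linarith [infDist_nonneg (x := (0 : E)) (s := Λ)]
  have hlogA : 0 ≤ Real.log A := Real.log_nonneg hA1
  have hlog2 : 0 ≤ Real.log 2 := Real.log_nonneg one_le_two
  set c₀ := |Real.log K| + q * Real.log A + q * Real.log 2 +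
    |Real.log (2 * M * (J + 1))| + n * Real.log 2 with hc₀
  have hc₀0 : 0 ≤ c₀ := by positivity
  set c₂ := K + n * (K / q) with hc₂
  have hc₂0 : 0 ≤ c₂ := by positivity
  refine ⟨c₀ + (q + p) / α + c₂, by positivity, fun ε ρ hε hε1 hρ y hy => ?_⟩
  have hint := hρ.integrable_mul hp hε1 hf hfL y
  have hlow := hρ.lower_bound hΛne hΛc hΛ0 hK hq (fun y hy => (hbound y hy).1) hε1 hint
  have hd : 0 < infDist y Λ := (hΛc.notMem_iff_infDist_pos hΛne).1 hy
  have hT1 : 1 ≤ 1 + ‖y‖ := by linarith [norm_nonneg y]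
  have hlogd : q * -Real.log (infDist y Λ) ≤ K * f y := by
    have h1 := Real.log_le_self (Real.rpow_nonneg hd.le (-q))
    rw [Real.log_rpow hd] at h1
    have h2 := (hbound y hy).1
    rw [inv_mul_le_iff₀ hK] at h2
    linarith
  have hfy : 0 ≤ f y := le_trans (by positivity) (hbound y hy).1
  set d := infDist y Λ with hdd
  set T := 1 + ‖y‖ with hT
  have hT0 : 0 < T := by linarith
  have hlogT : 0 ≤ Real.log T := Real.log_nonneg hT1
  set I := ∫ z, f (y - z) * ρ z with hI
  have hI0 : 0 < I := lt_of_lt_of_le (by positivity) hlow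
  have key : |Real.log I| ≤ c₀ + (q + p) * Real.log T + c₂ * f y := by
    have hc₂f : 0 ≤ c₂ * f y := mul_nonneg hc₂0 hfy
    have hqT : 0 ≤ q * Real.log T := by positivity
    have hpT : 0 ≤ p * Real.log T := by positivity
    have hqA : 0 ≤ q * Real.log A := by positivity
    have hq2 : 0 ≤ q * Real.log 2 := by positivity
    have hn2 : 0 ≤ n * Real.log 2 := by positivity
    have hK1 := le_abs_self (Real.log K)
    have hK2 := neg_abs_le (Real.log K)
    have hJ1 := le_abs_self (Real.log (2 * M * (J + 1)))
    have hJ2 := abs_nonneg (Real.log (2 * M * (J + 1)))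
    rw [abs_le]
    constructor
    · have h1 := Real.log_le_log (by positivity) hlow
      rw [Real.log_mul (by positivity) (by positivity), Real.log_inv,
        Real.log_rpow (by positivity), Real.log_mul (by positivity) (by positivity)] at h1
      linarith
    · rcases lt_or_ge ε (d / 2) with hεd | hεd
      · have h1 : I ≤ K * (d / 2) ^ (-q) := by
          refine hρ.integral_mul_le hint ?_
          filter_upwards [ae_sub_notMem hΛ0 y] with z hz hzε
          refine (hbound _ hz).2.trans ?_
          have h2 : d ≤ infDist (y - z) Λ + ‖z‖ := by
            have := infDist_le_infDist_add_dist (x := y) (y := y - z) (s := Λ)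
            rwa [dist_eq_norm, sub_sub_cancel] at this
          refine mul_le_mul_of_nonneg_left ?_ hK.le
          exact Real.rpow_le_rpow_of_nonpos (by positivity) (by linarith) (by linarith)
        have h2 := Real.log_le_log hI0 h1
        rw [Real.log_mul (by positivity) (by positivity), Real.log_rpow (by positivity),
          Real.log_div (by positivity) (by positivity)] at h2
        have h3 : K * f y ≤ c₂ * f y := by
          refine mul_le_mul_of_nonneg_right ?_ hfy
          rw [hc₂]
          have : 0 ≤ n * (K / q) := by positivity
          linarith
        linarith
      · have h1 : I ≤ (2 * M * (J + 1)) * T ^ p * ((d / 2) ^ n)⁻¹ := by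
          refine (hρ.integral_mul_le_weighted hp hε1 hfL y).trans ?_
          calc 2 * ((ε ^ n)⁻¹ * M) * (1 + ‖y‖) ^ p * J
              ≤ 2 * (((d / 2) ^ n)⁻¹ * M) * T ^ p * (J + 1) := by
                gcongr
                linarith
            _ = _ := by ring
        have h2 := Real.log_le_log hI0 h1
        rw [Real.log_mul (by positivity) (by positivity), Real.log_mul (by positivity)
          (by positivity), Real.log_rpow (by positivity), Real.log_inv, Real.log_pow,
          Real.log_div (by positivity) (by positivity)] at h2
        have h3 : n * -Real.log d ≤ n * (K / q) * f y := by
          rw [mul_assoc]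
          refine mul_le_mul_of_nonneg_left ?_ (by positivity)
          rw [div_mul_eq_mul_div, le_div_iff₀ hq]
          linarith
        have h4 : c₂ * f y = K * f y + n * (K / q) * f y := by rw [hc₂]; ring
        have h5 : 0 ≤ K * f y := by positivity
        linarith
  have hTα : 1 ≤ T ^ α := Real.one_le_rpow hT1 hα.le
  have hlogTα := Real.log_le_rpow_div hT0.le hα
  rw [abs_of_nonneg hfy]
  calc |Real.log I| ≤ c₀ + (q + p) * Real.log T + c₂ * f y := key
    _ ≤ c₀ * T ^ α + (q + p) * (T ^ α / α) + c₂ * f y := by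
        gcongr
        exact le_mul_of_one_le_right hc₀0 hTα
    _ = (c₀ + (q + p) / α) * T ^ α + c₂ * f y := by ring
    _ ≤ (c₀ + (q + p) / α + c₂) * T ^ α + (c₀ + (q + p) / α + c₂) * f y := by
        have : 0 ≤ (q + p) / α := by positivity
        exact add_le_add (mul_le_mul_of_nonneg_right (by linarith) (by positivity))
          (mul_le_mul_of_nonneg_right (by linarith) hfy)
    _ = _ := by ring

/-- The part near the origin of the dominating function of the fractional Laplacian. -/
theorem integrable_indicator_ball_sq_div_rpow [Nontrivial E] {α : ℝ} (hα : α < 1) (r C : ℝ) :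
    Integrable ((ball (0 : E) r).indicator
      fun y => C * ‖y‖ ^ 2 / ‖y‖ ^ ((Module.finrank ℝ E : ℝ) + 2 * α)) := by
  rw [integrable_indicator_iff measurableSet_ball,
    integrableOn_fun_norm_addHaar volume
      (f := fun s : ℝ => C * s ^ 2 / s ^ ((Module.finrank ℝ E : ℝ) + 2 * α))]
  have h1 : IntegrableOn (fun s : ℝ => C * s ^ (1 - 2 * α)) (Ioo 0 r) := by
    rcases le_total 0 r with hr | hr
    · exact (((intervalIntegrable_iff_integrableOn_Ioo_of_le hr).1
        (intervalIntegral.intervalIntegrable_rpow' (by linarith))).const_mul C)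
    · rw [Ioo_eq_empty (not_lt.2 hr)]; exact integrableOn_empty
  refine h1.congr_fun (fun s hs => ?_) measurableSet_Ioo
  have hs0 : 0 < s := hs.1
  have hn : 1 ≤ Module.finrank ℝ E := Module.finrank_pos
  change C * s ^ (1 - 2 * α) = _
  rw [smul_eq_mul, mul_div_assoc, mul_left_comm, mul_div_assoc', ← pow_add]
  congr 1
  rw [← Real.rpow_natCast, ← Real.rpow_sub hs0]
  congr 1
  push_cast [hn]
  ring

/-- The dominating function of the fractional Laplacian away from the origin. -/
theorem integrable_rpow_add_abs_mul_rpow_neg (hf : Measurable f) {α : ℝ} (hα : 0 < α)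
    (hfL : Integrable fun x => |f x| / (1 + ‖x‖ ^ ((Module.finrank ℝ E : ℝ) + 2 * α))) (C : ℝ) :
    Integrable fun x => C * ((1 + ‖x‖) ^ α + |f x|) *
      (1 + ‖x‖) ^ (-((Module.finrank ℝ E : ℝ) + 2 * α)) := by
  set p := (Module.finrank ℝ E : ℝ) + 2 * α with hp
  have hp0 : 0 ≤ p := by positivity
  have h1 : Integrable fun x : E => (1 + ‖x‖) ^ (-((Module.finrank ℝ E : ℝ) + α)) :=
    integrable_one_add_norm (by linarith)
  have h2 : Integrable fun x : E => |f x| * (1 + ‖x‖) ^ (-p) := by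
    refine (hfL.const_mul 2).mono' ?_ (Eventually.of_forall fun x => ?_)
    · exact (hf.abs.mul ((measurable_const.add measurable_norm).pow_const _)).aestronglyMeasurable
    · have h3 : ‖x‖ ^ p ≤ (1 + ‖x‖) ^ p :=
        Real.rpow_le_rpow (norm_nonneg _) (by linarith) hp0
      have h4 : 1 ≤ (1 + ‖x‖) ^ p := Real.one_le_rpow (by linarith [norm_nonneg x]) hp0
      rw [Real.norm_of_nonneg (by positivity), Real.rpow_neg (by positivity),
        ← div_eq_mul_inv, mul_div_assoc', div_le_div_iff₀ (by positivity) (by positivity)]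
      have := mul_le_mul_of_nonneg_left (show 1 + ‖x‖ ^ p ≤ 2 * (1 + ‖x‖) ^ p by linarith)
        (abs_nonneg (f x))
      linarith
  refine ((h1.add h2).const_mul C).congr (Eventually.of_forall fun x => ?_)
  have h5 : (1 + ‖x‖) ^ (-((Module.finrank ℝ E : ℝ) + α)) = (1 + ‖x‖) ^ α * (1 + ‖x‖) ^ (-p) := by
    rw [← Real.rpow_add (by positivity)]
    congr 1
    rw [hp]; ring
  simp only [Pi.add_apply, h5]
  ring

end LogMollification

theorem inv_norm_rpow_le {E : Type*} [NormedAddCommGroup E] {x y w : E} {r p : ℝ} (hr : 0 < r)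
    (hp : 0 ≤ p) (hy : r ≤ ‖y‖) (hw : ‖w‖ ≤ ‖x‖ + ‖y‖) :
    (‖y‖ ^ p)⁻¹ ≤ ((1 + ‖x‖) * (1 + r⁻¹)) ^ p * (1 + ‖w‖) ^ (-p) := by
  have hy0 : 0 < ‖y‖ := hr.trans_le hy
  have h1 : 1 + ‖w‖ ≤ (1 + ‖x‖) * (1 + r⁻¹) * ‖y‖ := by
    have h2 : 1 ≤ r⁻¹ * ‖y‖ := by rwa [← div_eq_inv_mul, one_le_div hr]
    have h3 := mul_le_mul_of_nonneg_left h2 (norm_nonneg x)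
    have h4 := mul_nonneg (norm_nonneg x) hy0.le
    nlinarith
  rw [Real.rpow_neg (by positivity), ← div_eq_mul_inv, inv_eq_one_div,
    div_le_div_iff₀ (by positivity) (by positivity), one_mul, ← Real.mul_rpow (by positivity)
    (by positivity)]
  exact Real.rpow_le_rpow (by positivity) h1 hp

section Mollify

variable {n : ℕ} {η f : EuclideanSpace ℝ (Fin n) → ℝ}

theorem measurable_mollify (hη : Continuous η) (hf : Measurable f) (ε : ℝ) :
    Measurable (mollify η f ε) := by
  refine (StronglyMeasurable.integral_prod_right (ν := volume) ?_).measurable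
  refine Measurable.stronglyMeasurable ?_
  exact (hf.comp (measurable_fst.sub measurable_snd)).mul
    (measurable_const.mul (hη.measurable.comp (measurable_snd.const_smul ε⁻¹)))

theorem tendsto_mollify (hη : Continuous η)
    (hηs : tsupport η ⊆ ball (0 : EuclideanSpace ℝ (Fin n)) 1) (hηnn : ∀ x, 0 ≤ η x)
    (hηint : (∫ x, η x) = 1) (hf : Measurable f) {p : ℝ} (hp : 0 ≤ p)
    (hfL : Integrable fun x => |f x| / (1 + ‖x‖ ^ p)) {y : EuclideanSpace ℝ (Fin n)}
    (hfy : ContinuousAt f y) :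
    Tendsto (fun ε => mollify η f ε y) (nhdsWithin 0 (Ioi 0)) (nhds (f y)) := by
  obtain ⟨M, -, hM⟩ := exists_forall_le_of_tsupport_subset_ball hη hηs
  rw [Metric.tendsto_nhds]
  intro δ hδ
  obtain ⟨r, hr, hfr⟩ := Metric.continuousAt_iff.1 hfy (δ / 2) (half_pos hδ)
  filter_upwards [Ioo_mem_nhdsGT (lt_min hr one_pos)] with ε hε
  have hρ := isBallDensity_rescale hη hηs hηnn hηint hM hε.1
  have hε1 : ε ≤ 1 := (hε.2.trans_le (min_le_right _ _)).le
  have hint := hρ.integrable_mul hp hε1 hf hfL y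
  have hz : ∀ z : EuclideanSpace ℝ (Fin n), ‖z‖ < ε → |f (y - z) - f y| ≤ δ / 2 := fun z hz => by
    rw [← Real.dist_eq]
    refine (hfr ?_).le
    rw [dist_eq_norm, sub_sub_cancel_left, norm_neg]
    exact hz.trans (hε.2.trans_le (min_le_left _ _))
  have h1 : mollify η f ε y ≤ f y + δ / 2 :=
    hρ.integral_mul_le hint (Eventually.of_forall fun z h => by linarith [(abs_le.1 (hz z h)).2])
  have h2 : f y - δ / 2 ≤ mollify η f ε y :=
    hρ.le_integral_mul hint (Eventually.of_forall fun z h => by linarith [(abs_le.1 (hz z h)).1])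
  rw [Real.dist_eq, abs_lt]
  constructor <;> linarith

end Mollify

/-- For every `x ∉ Λ`, `L_α(log f_ε)(x) → L_α(log f)(x)` as `ε → 0⁺`. -/
theorem stmt_15 (n : ℕ) (α : ℝ) (hα : α ∈ Set.Ioo (0 : ℝ) 1)
    (Λ : Set (EuclideanSpace ℝ (Fin n))) (hΛne : Λ.Nonempty) (hΛc : IsClosed Λ)
    (hΛ0 : volume Λ = 0)
    (η : EuclideanSpace ℝ (Fin n) → ℝ) (hη : ContDiff ℝ (⊤ : ℕ∞) η)
    (hηs : tsupport η ⊆ ball (0 : EuclideanSpace ℝ (Fin n)) 1)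
    (hηnn : ∀ x, 0 ≤ η x) (hηint : (∫ x, η x) = 1)
    (f : EuclideanSpace ℝ (Fin n) → ℝ) (hmeas : Measurable f)
    (hfL : Integrable (fun x => |f x| / (1 + ‖x‖ ^ ((n : ℝ) + 2 * α))) volume)
    (hfs : ContDiffOn ℝ (⊤ : ℕ∞) f Λᶜ) (hfpos : ∀ y ∉ Λ, 0 < f y)
    (K q : ℝ) (hK : 0 < K) (hq : 0 < q)
    (hbound : ∀ y ∉ Λ,
      K⁻¹ * Metric.infDist y Λ ^ (-q) ≤ f y ∧ f y ≤ K * Metric.infDist y Λ ^ (-q))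
    (τ : ℝ) (hτ : 1 < τ)
    (hloc : ∀ s : Set (EuclideanSpace ℝ (Fin n)), IsCompact s →
      IntegrableOn (fun y => |f y| ^ τ) s volume) :
    ∀ x ∉ Λ,
      Tendsto (fun ε : ℝ => fracLap n α (fun y => Real.log (mollify η f ε y)) x)
        (nhdsWithin 0 (Set.Ioi 0)) (nhds (fracLap n α (fun y => Real.log (f y)) x)) := by
  intro x hx
  have hne : Nontrivial (EuclideanSpace ℝ (Fin n)) := by
    obtain ⟨w, hw⟩ := hΛne
    exact ⟨x, w, fun h => hx (h ▸ hw)⟩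
  set p : ℝ := (n : ℝ) + 2 * α with hp
  have hα0 := hα.1
  have hp0 : 0 ≤ p := by positivity
  have hdim : (Module.finrank ℝ (EuclideanSpace ℝ (Fin n)) : ℝ) = n := by
    rw [finrank_euclideanSpace_fin]
  have hsmooth : ∀ y ∉ Λ, ContDiffAt ℝ (⊤ : ℕ∞) f y := fun y hy =>
    hfs.contDiffAt (hΛc.isOpen_compl.mem_nhds hy)
  obtain ⟨M, hM0, hM⟩ := exists_forall_le_of_tsupport_subset_ball hη.continuous hηs
  have hρ : ∀ ε : ℝ, 0 < ε → IsBallDensity (fun z => (ε ^ n)⁻¹ * η (ε⁻¹ • z)) ε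
      ((ε ^ n)⁻¹ * M) := fun ε hε => isBallDensity_rescale hη.continuous hηs hηnn hηint hM hε
  obtain ⟨C, hC0, hC⟩ := exists_abs_log_average_le hΛne hΛc hΛ0 hmeas hp0 hfL hK hq hbound hM0 n
    hα0
  obtain ⟨r, hr, S, -, hS⟩ := exists_abs_log_average_second_difference_le
    ((hsmooth x hx).of_le (WithTop.coe_le_coe.2 (le_top : (2 : ℕ∞) ≤ ⊤))) (hfpos x hx)
  set H : EuclideanSpace ℝ (Fin n) → ℝ := fun z => C * ((1 + ‖z‖) ^ α + |f z|) with hH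
  set W : EuclideanSpace ℝ (Fin n) → ℝ := fun z => (1 + ‖z‖) ^ (-p) with hW
  have hHW : Integrable fun z => H z * W z := by
    have := integrable_rpow_add_abs_mul_rpow_neg hmeas hα0 (by rwa [hdim]) C
    rwa [hdim] at this
  have hWint : Integrable W := integrable_one_add_norm (by rw [hdim]; linarith)
  have hH0 : ∀ z, 0 ≤ H z := fun z => by positivity
  have hW0 : ∀ z, 0 ≤ W z := fun z => by positivity
  set A := ((1 + ‖x‖) * (1 + r⁻¹)) ^ p with hA
  have hA0 : 0 ≤ A := by positivity
  have hnear : Integrable ((ball (0 : EuclideanSpace ℝ (Fin n)) r).indicator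
      fun y => S * ‖y‖ ^ 2 / ‖y‖ ^ p) := by
    have := integrable_indicator_ball_sq_div_rpow (E := EuclideanSpace ℝ (Fin n)) hα.2 r S
    rwa [hdim] at this
  have hfar : Integrable fun y => A * (H (x + y) * W (x + y) + H (x - y) * W (x - y) +
      2 * H x * W (x + y)) :=
    (((hHW.comp_add_left x).add (hHW.comp_sub_left x)).add
      ((hWint.comp_add_left x).const_mul _)).const_mul _
  unfold fracLap
  refine Tendsto.neg (tendsto_integral_filter_of_dominated_convergence _ ?_ ?_
    (hnear.add hfar) ?_)
  · refine Eventually.of_forall fun ε => Measurable.aestronglyMeasurable ?_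
    have hm := (measurable_mollify hη.continuous hmeas ε).log
    exact (((hm.comp (measurable_const.add measurable_id)).add
      (hm.comp (measurable_const.sub measurable_id))).sub measurable_const).div
      (measurable_norm.pow_const _)
  · filter_upwards [Ioo_mem_nhdsGT (lt_min hr one_pos)] with ε hε
    have hεr : ε ≤ r := (hε.2.trans_le (min_le_left _ _)).le
    have hε1 : ε ≤ 1 := (hε.2.trans_le (min_le_right _ _)).le
    filter_upwards [ae_add_notMem hΛ0 x, ae_sub_notMem hΛ0 x] with y hy₁ hy₂
    have hfar0 : 0 ≤ A * (H (x + y) * W (x + y) + H (x - y) * W (x - y) +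
        2 * H x * W (x + y)) := by
      have := hH0 x
      have := mul_nonneg (hH0 (x + y)) (hW0 (x + y))
      have := mul_nonneg (hH0 (x - y)) (hW0 (x - y))
      have := mul_nonneg (hH0 x) (hW0 (x + y))
      exact mul_nonneg hA0 (by linarith)
    have hyp : 0 ≤ ‖y‖ ^ p := by positivity
    rw [Pi.add_apply, norm_div, Real.norm_eq_abs, Real.norm_of_nonneg hyp]
    rcases lt_or_ge ‖y‖ r with hyr | hyr
    · rw [indicator_of_mem (mem_ball_zero_iff.2 hyr)]
      refine le_add_of_le_of_nonneg ?_ hfar0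
      exact div_le_div_of_nonneg_right
        (hS ε _ _ hεr (hρ ε hε.1) (fun y => (hρ ε hε.1).integrable_mul hp0 hε1 hmeas hfL y) y hyr)
        hyp
    · rw [indicator_of_notMem (by rw [mem_ball_zero_iff]; exact not_lt.2 hyr), zero_add]
      have h0 : |Real.log (mollify η f ε x)| ≤ H x := hC ε _ hε.1 hε1 (hρ ε hε.1) x hx
      have h1 : |Real.log (mollify η f ε (x + y))| ≤ H (x + y) :=
        hC ε _ hε.1 hε1 (hρ ε hε.1) _ hy₁
      have h2 : |Real.log (mollify η f ε (x - y))| ≤ H (x - y) :=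
        hC ε _ hε.1 hε1 (hρ ε hε.1) _ hy₂
      have h3 : |Real.log (mollify η f ε (x + y)) + Real.log (mollify η f ε (x - y)) -
          2 * Real.log (mollify η f ε x)| ≤ H (x + y) + H (x - y) + 2 * H x := by
        rw [abs_le] at h0 h1 h2 ⊢
        constructor <;> linarith [h0.1, h0.2, h1.1, h1.2, h2.1, h2.2]
      have h4 : (‖y‖ ^ p)⁻¹ ≤ A * W (x + y) := inv_norm_rpow_le hr hp0 hyr (norm_add_le x y)
      have h5 : (‖y‖ ^ p)⁻¹ ≤ A * W (x - y) := inv_norm_rpow_le hr hp0 hyr (norm_sub_le x y)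
      rw [div_eq_mul_inv]
      calc _ ≤ (H (x + y) + H (x - y) + 2 * H x) * (‖y‖ ^ p)⁻¹ := by gcongr
        _ = H (x + y) * (‖y‖ ^ p)⁻¹ + H (x - y) * (‖y‖ ^ p)⁻¹ + 2 * H x * (‖y‖ ^ p)⁻¹ := by ring
        _ ≤ H (x + y) * (A * W (x + y)) + H (x - y) * (A * W (x - y)) +
            2 * H x * (A * W (x + y)) := by
          have := hH0 x
          have := hH0 (x + y)
          have := hH0 (x - y)
          gcongr
        _ = _ := by ring
  · have hlim : ∀ y ∉ Λ, Tendsto (fun ε => Real.log (mollify η f ε y)) (nhdsWithin 0 (Ioi 0))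
        (nhds (Real.log (f y))) := fun y hy =>
      (tendsto_mollify hη.continuous hηs hηnn hηint hmeas hp0 hfL
        (hsmooth y hy).continuousAt).log (hfpos y hy).ne'
    filter_upwards [ae_add_notMem hΛ0 x, ae_sub_notMem hΛ0 x] with y hy₁ hy₂
    exact (((hlim _ hy₁).add (hlim _ hy₂)).sub ((hlim x hx).const_mul 2)).div_const _
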